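/- For every z ∈ ℝ, the following integral identity holds: ∫₀^∞ log((e^s + 1)/(e^s + e^z)) ds = π²/12 − ∫₀^{e^z} (log(1+t)/t) dt. Consequently the two expressions for g in the paper's display (5.3) agree: (2/π)^{1/4}·e^z·exp(∫₀^∞ log((e^s+1)/(e^s+e^z)) ds) = (2/π)^{1/4}·exp(π²/12 + z − ∫₀^{e^z} (log(1+t)/t) dt). -/

import Mathlib

open Real Set Filter Topology MeasureTheory

theorem abs_log_one_add_div_le_one {t : ℝ} (ht : 0 < t) : |log (1 + t) / t| ≤ 1 := by
  rw [abs_of_nonneg (div_nonneg (log_nonneg (by linarith)) ht.le), div_le_one ht]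
  linarith [log_le_sub_one_of_pos (show 0 < 1 + t by linarith)]

theorem measurable_log_one_add_div : Measurable fun t : ℝ => log (1 + t) / t := by
  fun_prop

theorem intervalIntegrable_log_one_add_div {x : ℝ} (hx : 0 ≤ x) :
    IntervalIntegrable (fun t : ℝ => log (1 + t) / t) volume 0 x := by
  refine (intervalIntegrable_const (c := (1 : ℝ))).mono_fun
    measurable_log_one_add_div.aestronglyMeasurable ?_
  filter_upwards [ae_restrict_mem measurableSet_uIoc] with t ht
  rw [uIoc_of_le hx] at ht
  simpa only [norm_eq_abs, abs_one] using abs_log_one_add_div_le_one ht.1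

theorem hasDerivAt_integral_log_one_add_div {x : ℝ} (hx : 0 < x) :
    HasDerivAt (fun y : ℝ => ∫ t in (0 : ℝ)..y, log (1 + t) / t) (log (1 + x) / x) x := by
  refine intervalIntegral.integral_hasDerivAt_right (intervalIntegrable_log_one_add_div hx.le)
    measurable_log_one_add_div.stronglyMeasurable.stronglyMeasurableAtFilter ?_
  have h : 1 + x ≠ 0 := by positivity
  exact ((continuousAt_const.add continuousAt_id).log h).div continuousAt_id hx.ne'

theorem abs_integral_log_one_add_div_le {x : ℝ} (hx : 0 ≤ x) :
    |∫ t in (0 : ℝ)..x, log (1 + t) / t| ≤ x := by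
  have h := intervalIntegral.norm_integral_le_of_norm_le_const (a := 0) (b := x) (C := 1)
    (f := fun t : ℝ => log (1 + t) / t) fun t ht => by
      rw [uIoc_of_le hx] at ht
      exact abs_log_one_add_div_le_one ht.1
  simpa [abs_of_nonneg hx] using h

theorem hasDerivAt_neg_integral_log_comp_mul_exp_neg {a : ℝ} (ha : 0 < a) (s : ℝ) :
    HasDerivAt (fun s : ℝ => -∫ t in (0 : ℝ)..a * exp (-s), log (1 + t) / t)
      (log (1 + a * exp (-s))) s := by
  have hpos : 0 < a * exp (-s) := by positivity
  have h := ((hasDerivAt_integral_log_one_add_div hpos).comp s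
    (((hasDerivAt_id s).neg.exp).const_mul a)).neg
  refine h.congr_deriv ?_
  simp only [id, Pi.neg_apply]
  field_simp

theorem tendsto_neg_integral_log_comp_mul_exp_neg {a : ℝ} (ha : 0 < a) :
    Tendsto (fun s : ℝ => -∫ t in (0 : ℝ)..a * exp (-s), log (1 + t) / t) atTop (𝓝 0) := by
  refine squeeze_zero_norm (a := fun s => a * exp (-s)) (fun s => ?_) ?_
  · rw [norm_neg]
    exact abs_integral_log_one_add_div_le (by positivity)
  · simpa using tendsto_exp_neg_atTop_nhds_zero.const_mul a

theorem integrableOn_log_one_add_mul_exp_neg {a : ℝ} (ha : 0 < a) :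
    IntegrableOn (fun s : ℝ => log (1 + a * exp (-s))) (Ioi 0) :=
  integrableOn_Ioi_deriv_of_nonneg'
    (fun s _ => hasDerivAt_neg_integral_log_comp_mul_exp_neg ha s)
    (fun s _ => log_nonneg (by linarith [mul_pos ha (exp_pos (-s))]))
    (tendsto_neg_integral_log_comp_mul_exp_neg ha)

theorem integral_log_one_add_mul_exp_neg {a : ℝ} (ha : 0 < a) :
    ∫ s in Ioi (0 : ℝ), log (1 + a * exp (-s)) = ∫ t in (0 : ℝ)..a, log (1 + t) / t := by
  rw [integral_Ioi_of_hasDerivAt_of_tendsto'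
    (fun s _ => hasDerivAt_neg_integral_log_comp_mul_exp_neg ha s)
    (integrableOn_log_one_add_mul_exp_neg ha) (tendsto_neg_integral_log_comp_mul_exp_neg ha)]
  simp

theorem hasSum_neg_one_pow_div_succ_sq :
    HasSum (fun n : ℕ => (-1 : ℝ) ^ n / ((n : ℝ) + 1) ^ 2) (π ^ 2 / 12) := by
  have heven : HasSum (fun n : ℕ => if Even n then (1 : ℝ) / (n : ℝ) ^ 2 else 0)
      (π ^ 2 / 24) := by
    have hinj : Function.Injective fun n : ℕ => 2 * n := fun m n h => by
      simpa using h
    rw [← hinj.hasSum_iff]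
    · convert! hasSum_zeta_two.mul_left (1 / 4) using 1
      · ext n
        simp only [Function.comp_apply, even_two_mul, if_true]
        push_cast
        rw [mul_pow, div_mul_div_comm]
        norm_num
      · ring
    · intro n hn
      rw [if_neg]
      rintro ⟨k, rfl⟩
      exact hn ⟨k, by ring⟩
  have h := hasSum_zeta_two.sub (heven.mul_left 2)
  rw [← hasSum_nat_add_iff' 1] at h
  convert! h using 1
  · ext n
    rcases Nat.even_or_odd n with hn | hn
    · simp [hn, hn.neg_one_pow, Nat.even_add_one]
    · have h' : ¬Even n := Nat.not_even_iff_odd.2 hn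
      simp only [hn.neg_one_pow, Nat.even_add_one, h', not_false_eq_true, if_true]
      push_cast
      ring
  · simp
    ring

theorem integral_log_one_add_div_zero_one :
    ∫ t in (0 : ℝ)..1, log (1 + t) / t = π ^ 2 / 12 := by
  have hint (n : ℕ) : ∫ t in Ioc (0 : ℝ) 1, t ^ n / ((n : ℝ) + 1) = 1 / ((n : ℝ) + 1) ^ 2 := by
    rw [← intervalIntegral.integral_of_le zero_le_one, intervalIntegral.integral_div,
      integral_pow]
    simp
    field_simp
  have hsum := hasSum_integral_of_summable_integral_norm (μ := volume.restrict (Ioc (0 : ℝ) 1))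
    (F := fun (n : ℕ) (t : ℝ) => (-1) ^ n * (t ^ n / ((n : ℝ) + 1)))
    (fun n => (Continuous.integrableOn_Ioc (by fun_prop))) (by
      have hs : Summable fun n : ℕ => 1 / ((n : ℝ) + 1) ^ 2 := by
        simpa using (summable_nat_add_iff 1).2 hasSum_zeta_two.summable
      refine hs.congr fun n => ?_
      rw [← hint n]
      refine setIntegral_congr_fun measurableSet_Ioc fun t ht => ?_
      have : 0 ≤ t ^ n / ((n : ℝ) + 1) := div_nonneg (pow_nonneg ht.1.le n) (by positivity)
      simp [norm_mul, abs_of_nonneg ht.1.le, abs_of_nonneg (show (0 : ℝ) ≤ n + 1 by positivity)])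
  have hval (n : ℕ) : ∫ t in Ioc (0 : ℝ) 1, (-1 : ℝ) ^ n * (t ^ n / ((n : ℝ) + 1)) =
      (-1) ^ n / ((n : ℝ) + 1) ^ 2 := by
    rw [integral_const_mul, hint, mul_one_div]
  simp only [hval] at hsum
  rw [hasSum_neg_one_pow_div_succ_sq.unique hsum,
    intervalIntegral.integral_of_le zero_le_one]
  refine integral_congr_ae ?_
  filter_upwards [ae_restrict_mem measurableSet_Ioc, ae_restrict_of_ae (Measure.ae_ne volume (1:ℝ))]
    with t ht ht1
  have h := (hasSum_pow_div_log_of_abs_lt_one (x := -t)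
    (by rw [abs_neg, abs_of_pos ht.1]; exact lt_of_le_of_ne ht.2 ht1)).mul_left (-1 / t)
  have htne : t ≠ 0 := ht.1.ne'
  refine Eq.trans ?_ (h.tsum_eq.symm.trans (tsum_congr fun n => ?_))
  · rw [sub_neg_eq_add]; ring
  · rw [neg_pow, pow_succ, pow_succ]
    field_simp

/-- For every `z ∈ ℝ`,
`∫₀^∞ log((eˢ + 1)/(eˢ + e^z)) ds = π²/12 - ∫₀^{e^z} log(1+t)/t dt`,
and consequently the two expressions for `g` in display (5.3) of the paper agree. -/
theorem integral_log_ratio_exp_identity (z : ℝ) :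
    (∫ s in Set.Ioi (0 : ℝ),
        Real.log ((Real.exp s + 1) / (Real.exp s + Real.exp z))) =
      Real.pi ^ 2 / 12 - ∫ t in (0 : ℝ)..(Real.exp z), Real.log (1 + t) / t ∧
    (2 / Real.pi) ^ ((1 : ℝ) / 4) * Real.exp z *
        Real.exp (∫ s in Set.Ioi (0 : ℝ),
          Real.log ((Real.exp s + 1) / (Real.exp s + Real.exp z))) =
      (2 / Real.pi) ^ ((1 : ℝ) / 4) *
        Real.exp (Real.pi ^ 2 / 12 + z -
          ∫ t in (0 : ℝ)..(Real.exp z), Real.log (1 + t) / t) := by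
  have hform : (∫ s in Set.Ioi (0 : ℝ),
        Real.log ((Real.exp s + 1) / (Real.exp s + Real.exp z))) =
      Real.pi ^ 2 / 12 - ∫ t in (0 : ℝ)..(Real.exp z), Real.log (1 + t) / t := by
    rw [← integral_log_one_add_div_zero_one, ← integral_log_one_add_mul_exp_neg one_pos,
      ← integral_log_one_add_mul_exp_neg (exp_pos z),
      ← integral_sub (integrableOn_log_one_add_mul_exp_neg one_pos)
        (integrableOn_log_one_add_mul_exp_neg (exp_pos z))]
    congr 1 with s
    rw [← log_div (by positivity) (by positivity)]
    congr 1
    rw [exp_neg]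
    field_simp
  refine ⟨hform, ?_⟩
  rw [hform, mul_assoc, ← exp_add]
  ring_nf
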